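/- The projections to V_ℂ satisfy the direct sum decompositions pr_T(L₁ ∩ L₂') = ℂ·pr_T(v_f) ⊕ pr_T(L₁ ∩ L₂ ∩ S_ℂ^⊥) and pr_T(L₁ ∩ conj(L₂')) = ℂ·pr_T(v_{if}) ⊕ pr_T(L₁ ∩ conj(L₂) ∩ S_ℂ^⊥); in particular pr_T(v_f) ∉ pr_T(L₁ ∩ L₂ ∩ S_ℂ^⊥) and pr_T(v_{if}) ∉ pr_T(L₁ ∩ conj(L₂) ∩ S_ℂ^⊥). -/

import Mathlib

open Module TensorProduct

/-- The generalized tangent space `W = V ⊕ V*`. -/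
abbrev GT (V : Type*) [AddCommGroup V] [Module ℝ V] := V × Module.Dual ℝ V

/-- The canonical symmetric pairing `⟨X+ξ, Y+η⟩ = (1/2)(η(X) + ξ(Y))` on `W = V ⊕ V*`,
as a bilinear form. -/
noncomputable def gpairB (V : Type*) [AddCommGroup V] [Module ℝ V] :
    LinearMap.BilinForm ℝ (GT V) :=
  (1 / 2 : ℝ) •
    ((LinearMap.id : Module.Dual ℝ V →ₗ[ℝ] Module.Dual ℝ V).compl₁₂
        (LinearMap.snd ℝ V (Module.Dual ℝ V)) (LinearMap.fst ℝ V (Module.Dual ℝ V)) +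
      ((LinearMap.id : Module.Dual ℝ V →ₗ[ℝ] Module.Dual ℝ V).compl₁₂
        (LinearMap.snd ℝ V (Module.Dual ℝ V)) (LinearMap.fst ℝ V (Module.Dual ℝ V))).flip)

/-- A generalized almost complex structure on `V`. -/
def IsGacs {V : Type*} [AddCommGroup V] [Module ℝ V] (J : GT V →ₗ[ℝ] GT V) : Prop :=
  (∀ u, J (J u) = -u) ∧ (∀ u v, gpairB V (J u) v = - gpairB V u (J v))

/-- A generalized almost Hermitian structure on `V`. -/
structure IsGah {V : Type*} [AddCommGroup V] [Module ℝ V]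
    (G : GT V →ₗ[ℝ] GT V →ₗ[ℝ] ℝ) (J Gend : GT V →ₗ[ℝ] GT V) : Prop where
  gacs : IsGacs J
  symm : ∀ u v, G u v = G v u
  posdef : ∀ u, u ≠ 0 → 0 < G u u
  hermitian : ∀ u v, G (J u) (J v) = G u v
  gend_pair : ∀ u v, G u v = gpairB V (Gend u) v
  gend_sq : ∀ u, Gend (Gend u) = u

instance : RingHomSurjective (starRingEnd ℂ) := ⟨fun x => ⟨star x, by simp⟩⟩

/-- Complex conjugation on the complexification `ℂ ⊗ M` of a real module. -/
noncomputable def conjC (M : Type*) [AddCommGroup M] [Module ℝ M] :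
    (ℂ ⊗[ℝ] M) →ₛₗ[starRingEnd ℂ] (ℂ ⊗[ℝ] M) where
  toFun := LinearMap.rTensor M Complex.conjAe.toLinearMap
  map_add' x y := map_add _ x y
  map_smul' c x := by
    show LinearMap.rTensor M Complex.conjAe.toLinearMap (c • x) =
      (starRingEnd ℂ) c • LinearMap.rTensor M Complex.conjAe.toLinearMap x
    induction x using TensorProduct.induction_on with
    | zero => simp
    | tmul a m =>
        rw [smul_tmul', LinearMap.rTensor_tmul, LinearMap.rTensor_tmul, smul_tmul']
        congr 1
        simp [Complex.conjAe]
    | add x y hx hy =>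
        rw [smul_add, map_add, hx, hy, map_add, smul_add]

/-- The `(1,0)`-space (`i`-eigenspace) of the complexification of an endomorphism of `W`. -/
noncomputable def iEigen {V : Type*} [AddCommGroup V] [Module ℝ V]
    (J : GT V →ₗ[ℝ] GT V) : Submodule ℂ (ℂ ⊗[ℝ] GT V) :=
  @Module.End.eigenspace ℂ (ℂ ⊗[ℝ] GT V) _ _ _ (J.baseChange ℂ) Complex.I

/-- The projection `pr_T : W_ℂ → V_ℂ`. -/
noncomputable def prTc (V : Type*) [AddCommGroup V] [Module ℝ V] :
    (ℂ ⊗[ℝ] GT V) →ₗ[ℂ] ℂ ⊗[ℝ] V :=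
  (LinearMap.fst ℝ V (Module.Dual ℝ V)).baseChange ℂ

section Complexification

variable {M : Type*} [AddCommGroup M] [Module ℝ M]

theorem exists_eq_one_tmul_add_I_smul (x : ℂ ⊗[ℝ] M) :
    ∃ a b : M, x = (1 : ℂ) ⊗ₜ[ℝ] a + Complex.I • (1 : ℂ) ⊗ₜ[ℝ] b := by
  induction x using TensorProduct.induction_on with
  | zero => exact ⟨0, 0, by simp⟩
  | tmul z m =>
    refine ⟨z.re • m, z.im • m, ?_⟩
    rw [← smul_tmul, ← smul_tmul, smul_tmul', ← add_tmul]
    congr 1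
    apply Complex.ext <;> simp
  | add x y hx hy =>
    obtain ⟨a, b, rfl⟩ := hx
    obtain ⟨c, d, rfl⟩ := hy
    exact ⟨a + c, b + d, by simp only [tmul_add, smul_add]; abel⟩

theorem one_tmul_add_I_smul_inj {a b c d : M}
    (h : (1 : ℂ) ⊗ₜ[ℝ] a + Complex.I • (1 : ℂ) ⊗ₜ[ℝ] b =
      (1 : ℂ) ⊗ₜ[ℝ] c + Complex.I • (1 : ℂ) ⊗ₜ[ℝ] d) : a = c ∧ b = d := by
  constructor
  · simpa [smul_tmul'] using
      congrArg ((TensorProduct.lid ℝ M).toLinearMap ∘ₗ Complex.reLm.rTensor M) h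
  · simpa [smul_tmul'] using
      congrArg ((TensorProduct.lid ℝ M).toLinearMap ∘ₗ Complex.imLm.rTensor M) h

theorem conjC_one_tmul_add (a b : M) :
    conjC M ((1 : ℂ) ⊗ₜ[ℝ] a + Complex.I • (1 : ℂ) ⊗ₜ[ℝ] b) =
      (1 : ℂ) ⊗ₜ[ℝ] a - Complex.I • (1 : ℂ) ⊗ₜ[ℝ] b := by
  have h (c : M) : conjC M ((1 : ℂ) ⊗ₜ[ℝ] c) = (1 : ℂ) ⊗ₜ[ℝ] c := by
    change LinearMap.rTensor M Complex.conjAe.toLinearMap _ = _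
    simp
  rw [map_add, LinearMap.map_smulₛₗ, h, h, Complex.conj_I, neg_smul, sub_eq_add_neg]

theorem conjC_conjC (x : ℂ ⊗[ℝ] M) : conjC M (conjC M x) = x := by
  obtain ⟨a, b, rfl⟩ := exists_eq_one_tmul_add_I_smul x
  have := conjC_one_tmul_add a (-b)
  simp only [tmul_neg, smul_neg, sub_neg_eq_add, ← sub_eq_add_neg] at this
  rw [conjC_one_tmul_add, this]

end Complexification

section Eigenspaces

variable {V : Type*} [AddCommGroup V] [Module ℝ V]

theorem one_tmul_add_I_smul_mem_iEigen (K : GT V →ₗ[ℝ] GT V) (a b : GT V) :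
    (1 : ℂ) ⊗ₜ[ℝ] a + Complex.I • (1 : ℂ) ⊗ₜ[ℝ] b ∈ iEigen K ↔ K a = -b ∧ K b = a := by
  have hI : Complex.I • ((1 : ℂ) ⊗ₜ[ℝ] a + Complex.I • (1 : ℂ) ⊗ₜ[ℝ] b) =
      (1 : ℂ) ⊗ₜ[ℝ] (-b) + Complex.I • (1 : ℂ) ⊗ₜ[ℝ] a := by
    rw [smul_add, smul_smul, Complex.I_mul_I, tmul_neg, neg_one_smul, add_comm]
  have hm : (1 : ℂ) ⊗ₜ[ℝ] a + Complex.I • (1 : ℂ) ⊗ₜ[ℝ] b ∈ iEigen K ↔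
      (1 : ℂ) ⊗ₜ[ℝ] K a + Complex.I • (1 : ℂ) ⊗ₜ[ℝ] K b =
        (1 : ℂ) ⊗ₜ[ℝ] (-b) + Complex.I • (1 : ℂ) ⊗ₜ[ℝ] a := by
    rw [iEigen, Module.End.mem_eigenspace_iff, hI, map_add, map_smul,
      LinearMap.baseChange_tmul, LinearMap.baseChange_tmul]
  rw [hm]
  exact ⟨one_tmul_add_I_smul_inj, fun h => by rw [h.1, h.2]⟩

theorem map_conjC_iEigen (K : GT V →ₗ[ℝ] GT V) :
    (iEigen K).map (conjC (GT V)) = iEigen (-K) := by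
  have key (L : GT V →ₗ[ℝ] GT V) (x : ℂ ⊗[ℝ] GT V) (hx : x ∈ iEigen L) :
      conjC (GT V) x ∈ iEigen (-L) := by
    obtain ⟨a, b, rfl⟩ := exists_eq_one_tmul_add_I_smul x
    rw [one_tmul_add_I_smul_mem_iEigen] at hx
    rw [conjC_one_tmul_add, sub_eq_add_neg, ← smul_neg, ← tmul_neg,
      one_tmul_add_I_smul_mem_iEigen]
    simp [hx.1, hx.2]
  apply le_antisymm
  · rintro _ ⟨x, hx, rfl⟩
    exact key K x hx
  · intro x hx
    have hK : -(-K) = K := LinearMap.ext fun u => neg_neg (K u)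
    exact ⟨conjC _ x, hK ▸ key _ x hx, conjC_conjC x⟩

/-- The parametrization `a ↦ a - i J a` of the `i`-eigenspace of `J` by real vectors. -/
noncomputable def toIEigen (J : GT V →ₗ[ℝ] GT V) : GT V →ₗ[ℝ] ℂ ⊗[ℝ] GT V :=
  TensorProduct.mk ℝ ℂ (GT V) 1 - Complex.I • (TensorProduct.mk ℝ ℂ (GT V) 1 ∘ₗ J)

theorem toIEigen_apply (J : GT V →ₗ[ℝ] GT V) (a : GT V) :
    toIEigen J a = (1 : ℂ) ⊗ₜ[ℝ] a - Complex.I • (1 : ℂ) ⊗ₜ[ℝ] J a := rfl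

theorem toIEigen_eq_add (J : GT V →ₗ[ℝ] GT V) (a : GT V) :
    toIEigen J a = (1 : ℂ) ⊗ₜ[ℝ] a + Complex.I • (1 : ℂ) ⊗ₜ[ℝ] (-J a) := by
  rw [toIEigen_apply, tmul_neg, smul_neg, sub_eq_add_neg]

theorem I_smul_toIEigen {J : GT V →ₗ[ℝ] GT V} (hJ : ∀ u, J (J u) = -u) (a : GT V) :
    Complex.I • toIEigen J a = toIEigen J (J a) := by
  rw [toIEigen_apply, toIEigen_apply, hJ, smul_sub, smul_smul, Complex.I_mul_I, tmul_neg,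
    smul_neg, neg_one_smul]
  abel

theorem smul_toIEigen {J : GT V →ₗ[ℝ] GT V} (hJ : ∀ u, J (J u) = -u) (z : ℂ)
    (a : GT V) : z • toIEigen J a = toIEigen J (z.re • a + z.im • J a) := by
  rw [map_add, map_smul, map_smul, ← I_smul_toIEigen hJ]
  conv_lhs => rw [← Complex.re_add_im z, add_smul, mul_smul]
  rfl

theorem mem_iEigen_inf {J K : GT V →ₗ[ℝ] GT V} (hJ : ∀ u, J (J u) = -u)
    (hK : ∀ u, K (K u) = -u) (x : ℂ ⊗[ℝ] GT V) :
    x ∈ iEigen J ⊓ iEigen K ↔ ∃ a, K a = J a ∧ toIEigen J a = x := by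
  obtain ⟨a, b, rfl⟩ := exists_eq_one_tmul_add_I_smul x
  rw [Submodule.mem_inf, one_tmul_add_I_smul_mem_iEigen, one_tmul_add_I_smul_mem_iEigen]
  constructor
  · rintro ⟨⟨h1, -⟩, h2, -⟩
    exact ⟨a, h2.trans h1.symm, by rw [toIEigen_eq_add, h1, neg_neg]⟩
  · rintro ⟨c, hc, h⟩
    rw [toIEigen_eq_add] at h
    obtain ⟨rfl, rfl⟩ := one_tmul_add_I_smul_inj h
    refine ⟨⟨by simp, by simp [hJ]⟩, by simp [hc], ?_⟩
    rw [← hc, map_neg, hK, neg_neg]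

theorem prTc_toIEigen_eq_iff (J : GT V →ₗ[ℝ] GT V) (a b : GT V) :
    prTc V (toIEigen J a) = prTc V (toIEigen J b) ↔ a.1 = b.1 ∧ (J a).1 = (J b).1 := by
  have h (c : GT V) : prTc V (toIEigen J c) =
      (1 : ℂ) ⊗ₜ[ℝ] c.1 + Complex.I • (1 : ℂ) ⊗ₜ[ℝ] (-(J c).1) := by
    rw [toIEigen_eq_add, prTc, map_add, map_smul, LinearMap.baseChange_tmul,
      LinearMap.baseChange_tmul]
    rfl
  rw [h, h]
  constructor
  · intro h
    obtain ⟨h1, h2⟩ := one_tmul_add_I_smul_inj h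
    exact ⟨h1, neg_injective h2⟩
  · rintro ⟨h1, h2⟩
    rw [h1, h2]

theorem one_tmul_add_I_smul_mem_orthogonal (B : LinearMap.BilinForm ℝ (GT V))
    (S : Submodule ℝ (GT V)) (a b : GT V) :
    (1 : ℂ) ⊗ₜ[ℝ] a + Complex.I • (1 : ℂ) ⊗ₜ[ℝ] b ∈
        (B.baseChange ℂ).orthogonal (S.baseChange ℂ) ↔
      ∀ s ∈ S, B s a = 0 ∧ B s b = 0 := by
  have key (s : GT V) : B.baseChange ℂ ((1 : ℂ) ⊗ₜ[ℝ] s)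
      ((1 : ℂ) ⊗ₜ[ℝ] a + Complex.I • (1 : ℂ) ⊗ₜ[ℝ] b) = B s a + B s b * Complex.I := by
    rw [map_add, map_smul, LinearMap.BilinForm.baseChange_tmul,
      LinearMap.BilinForm.baseChange_tmul]
    simp [mul_comm]
  rw [LinearMap.BilinForm.mem_orthogonal_iff]
  constructor
  · intro h s hs
    have := h _ (Submodule.tmul_mem_baseChange_of_mem (1 : ℂ) hs)
    rw [key] at this
    simpa using And.intro (congrArg Complex.re this) (congrArg Complex.im this)
  · intro h x hx
    rw [Submodule.baseChange_eq_span] at hx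
    induction hx using Submodule.span_induction with
    | mem x hx =>
      obtain ⟨s, hs, rfl⟩ := hx
      refine (key s).trans ?_
      simp [h s hs]
    | zero => simp
    | add x y _ _ hx hy => simp [hx, hy]
    | smul c x _ hx => simp [hx]

end Eigenspaces

section Pairing

variable {V : Type*} [AddCommGroup V] [Module ℝ V]

theorem gpairB_apply (u v : GT V) : gpairB V u v = 1 / 2 * (u.2 v.1 + v.2 u.1) := rfl

theorem gpairB_comm (u v : GT V) : gpairB V u v = gpairB V v u := by
  rw [gpairB_apply, gpairB_apply, add_comm]

theorem gpairB_self_of_fst_eq_zero {u : GT V} (h : u.1 = 0) : gpairB V u u = 0 := by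
  simp [gpairB_apply, h]

/-- The span of `e, J e, J₂ e, J₃ e` for the quaternion-like triple of `(J, Gend)`. -/
def quatSpan (J Gend : GT V →ₗ[ℝ] GT V) (e : GT V) : Submodule ℝ (GT V) :=
  Submodule.span ℝ {e, J e, (Gend ∘ₗ J) e, (J ∘ₗ Gend ∘ₗ J) e}

namespace IsGah

variable {G : GT V →ₗ[ℝ] GT V →ₗ[ℝ] ℝ} {J Gend : GT V →ₗ[ℝ] GT V}

theorem J_sq (h : IsGah G J Gend) (u : GT V) : J (J u) = -u := h.gacs.1 u

theorem gpairB_J_left (h : IsGah G J Gend)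
    (u v : GT V) : gpairB V (J u) v = -gpairB V u (J v) := h.gacs.2 u v

theorem gpairB_Gend_left (h : IsGah G J Gend)
    (u v : GT V) : gpairB V (Gend u) v = gpairB V u (Gend v) := by
  rw [← h.gend_pair, h.symm, h.gend_pair, gpairB_comm]

theorem eq_zero_of_gpairB (h : IsGah G J Gend) {u : GT V} (hu : ∀ v, gpairB V u v = 0) : u = 0 := by
  by_contra hne
  have := h.posdef u hne
  rw [h.gend_pair, gpairB_comm, hu] at this
  exact this.false

theorem Gend_J (h : IsGah G J Gend) (u : GT V) : Gend (J u) = J (Gend u) := by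
  rw [← sub_eq_zero]
  refine h.eq_zero_of_gpairB fun v => ?_
  have := h.hermitian u (J v)
  rw [h.J_sq, h.gend_pair, h.gend_pair, map_neg] at this
  rw [map_sub, LinearMap.sub_apply, h.gpairB_J_left]
  linarith

theorem J_Gend_J (h : IsGah G J Gend) (u : GT V) : J (Gend (J u)) = -Gend u := by
  rw [h.Gend_J, h.J_sq]

theorem gpairB_J_J (h : IsGah G J Gend) (u v : GT V) : gpairB V (J u) (J v) = gpairB V u v := by
  rw [h.gpairB_J_left, h.J_sq, map_neg, neg_neg]

theorem gpairB_self_J (h : IsGah G J Gend) (u : GT V) : gpairB V u (J u) = 0 := by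
  have := h.gpairB_J_left u u
  rw [gpairB_comm] at this
  linarith

theorem gpairB_self_J_Gend (h : IsGah G J Gend) (u : GT V) : gpairB V u (J (Gend u)) = 0 := by
  have := h.gpairB_J_left u (Gend u)
  rw [← h.gpairB_Gend_left (J u), h.Gend_J, gpairB_comm] at this
  linarith

theorem mem_orthogonal_quatSpan (h : IsGah G J Gend) (e w : GT V) :
    (∀ s ∈ quatSpan J Gend e, gpairB V w s = 0) ↔
      gpairB V w e = 0 ∧ gpairB V w (J e) = 0 ∧ gpairB V w (J (Gend e)) = 0 ∧
        gpairB V w (Gend e) = 0 := by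
  have : (∀ s ∈ quatSpan J Gend e, gpairB V w s = 0) ↔
      quatSpan J Gend e ≤ LinearMap.ker (gpairB V w) := Iff.rfl
  rw [this, quatSpan, Submodule.span_le]
  simp [Set.insert_subset_iff, h.Gend_J, h.J_sq]

theorem gpairB_quat (h : IsGah G J Gend) {e : GT V} (he : gpairB V e e = 0) (α β γ δ : ℝ) :
    gpairB V (α • e + β • J e + γ • J (Gend e) + δ • Gend e) e = δ * G e e ∧
    gpairB V (α • e + β • J e + γ • J (Gend e) + δ • Gend e) (J e) = γ * G e e ∧
    gpairB V (α • e + β • J e + γ • J (Gend e) + δ • Gend e) (J (Gend e)) = β * G e e ∧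
    gpairB V (α • e + β • J e + γ • J (Gend e) + δ • Gend e) (Gend e) = α * G e e := by
  have hG : gpairB V (Gend e) e = G e e := (h.gend_pair e e).symm
  have hG' : gpairB V e (Gend e) = G e e := by rw [gpairB_comm, hG]
  have hGG : gpairB V (Gend e) (Gend e) = 0 := by rw [h.gpairB_Gend_left, h.gend_sq, he]
  have h1 : gpairB V (J e) e = 0 := by rw [gpairB_comm, h.gpairB_self_J]
  have h2 : gpairB V (J (Gend e)) e = 0 := by rw [gpairB_comm, h.gpairB_self_J_Gend]
  have h3 : gpairB V (J (Gend e)) (Gend e) = 0 := by rw [gpairB_comm, h.gpairB_self_J]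
  have h4 : gpairB V (J e) (Gend e) = 0 := by
    rw [h.gpairB_J_left, h.gpairB_self_J_Gend, neg_zero]
  have h5 : gpairB V (Gend e) (J e) = 0 := by rw [gpairB_comm, h4]
  simp [h.gpairB_J_J, h.gpairB_self_J, h.gpairB_self_J_Gend, he, hG, hG', hGG, h1, h2, h3,
    h4, h5]

theorem exists_quat_add_orthogonal (h : IsGah G J Gend)
    {e : GT V} (he : gpairB V e e = 0) (he0 : e ≠ 0)
    (a : GT V) : ∃ α β γ δ : ℝ, ∃ t, a = α • e + β • J e + γ • J (Gend e) + δ • Gend e + t ∧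
      ∀ s ∈ quatSpan J Gend e, gpairB V t s = 0 := by
  have hg := (h.posdef e he0).ne'
  refine ⟨gpairB V a (Gend e) / G e e, gpairB V a (J (Gend e)) / G e e,
    gpairB V a (J e) / G e e, gpairB V a e / G e e, _, (add_sub_cancel _ _).symm, ?_⟩
  obtain ⟨h1, h2, h3, h4⟩ := h.gpairB_quat he (gpairB V a (Gend e) / G e e)
    (gpairB V a (J (Gend e)) / G e e) (gpairB V a (J e) / G e e) (gpairB V a e / G e e)
  rw [h.mem_orthogonal_quatSpan]
  simp only [map_sub, LinearMap.sub_apply]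
  rw [h1, h2, h3, h4]
  field_simp
  simp

theorem orthogonal_quatSpan_J (h : IsGah G J Gend) {e t : GT V}
    (ht : ∀ s ∈ quatSpan J Gend e, gpairB V t s = 0) :
    ∀ s ∈ quatSpan J Gend e, gpairB V (J t) s = 0 := by
  rw [h.mem_orthogonal_quatSpan] at ht ⊢
  simp [h.gpairB_J_left, h.J_sq, ht]

theorem orthogonal_quatSpan_Gend (h : IsGah G J Gend) {e t : GT V}
    (ht : ∀ s ∈ quatSpan J Gend e, gpairB V t s = 0) :
    ∀ s ∈ quatSpan J Gend e, gpairB V (Gend t) s = 0 := by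
  rw [h.mem_orthogonal_quatSpan] at ht ⊢
  simp [h.gpairB_Gend_left, h.Gend_J, h.gend_sq, ht]

theorem twist_apply (h : IsGah G J Gend) {e : GT V} {f : ℝ} (hf : f ≠ 0) {τ : GT V ≃ₗ[ℝ] GT V}
    (hτperp : ∀ w, (∀ s ∈ quatSpan J Gend e, gpairB V w s = 0) → τ w = w)
    (hτ0 : τ e = f • e) (hτ1 : τ (J e) = f • J e)
    (hτ2 : τ (J (Gend e)) = f⁻¹ • J (Gend e)) (hτ3 : τ (Gend e) = f⁻¹ • Gend e)
    (α β γ δ : ℝ) {t : GT V}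
    (ht : ∀ s ∈ quatSpan J Gend e, gpairB V t s = 0) :
    τ (Gend (J (τ.symm (α • e + β • J e + γ • J (Gend e) + δ • Gend e + t)))) =
      (-(f ^ 2 * γ)) • e + (f ^ 2 * δ) • J e + ((f ^ 2)⁻¹ * α) • J (Gend e) +
        (-((f ^ 2)⁻¹ * β)) • Gend e + Gend (J t) := by
  have hsymm : τ.symm (α • e + β • J e + γ • J (Gend e) + δ • Gend e + t) =
      (f⁻¹ * α) • e + (f⁻¹ * β) • J e + (f * γ) • J (Gend e) + (f * δ) • Gend e + t := by
    rw [LinearEquiv.symm_apply_eq]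
    simp only [map_add, map_smul, hτ0, hτ1, hτ2, hτ3, hτperp t ht, smul_smul]
    congr <;> field_simp
  have hJt := hτperp _ (h.orthogonal_quatSpan_Gend (h.orthogonal_quatSpan_J ht))
  rw [h.Gend_J] at hJt
  rw [hsymm]
  simp only [map_add, map_smul, map_neg, h.J_sq, h.Gend_J, h.gend_sq, hτ0, hτ1, hτ2, hτ3,
    hJt, smul_smul, smul_neg]
  have hff : f⁻¹ * α * f⁻¹ = (f ^ 2)⁻¹ * α := by field_simp
  have hff' : f⁻¹ * β * f⁻¹ = (f ^ 2)⁻¹ * β := by field_simp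
  rw [hff, hff']
  module

theorem twist_eq_iff (h : IsGah G J Gend) {e : GT V} {f : ℝ} (hf : f ≠ 0) {τ : GT V ≃ₗ[ℝ] GT V}
    (hτperp : ∀ w, (∀ s ∈ quatSpan J Gend e, gpairB V w s = 0) → τ w = w)
    (hτ0 : τ e = f • e) (hτ1 : τ (J e) = f • J e)
    (hτ2 : τ (J (Gend e)) = f⁻¹ • J (Gend e)) (hτ3 : τ (Gend e) = f⁻¹ • Gend e)
    (he : gpairB V e e = 0) (he0 : e ≠ 0) {σ : ℝ} (hσ : σ * σ = 1)
    (a : GT V) :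
    σ • τ (Gend (J (τ.symm a))) = J a ↔
      ∃ α β : ℝ, ∃ t, ((∀ s ∈ quatSpan J Gend e, gpairB V t s = 0) ∧
          σ • Gend (J t) = J t) ∧
        α • (e + (σ * (f ^ 2)⁻¹) • Gend e) + β • J (e + (σ * (f ^ 2)⁻¹) • Gend e) + t = a := by
  have hg := (h.posdef e he0).ne'
  have hf2 : f ^ 2 * (f ^ 2)⁻¹ = 1 := mul_inv_cancel₀ (pow_ne_zero 2 hf)
  constructor
  · intro heq
    obtain ⟨α, β, γ, δ, t, rfl, ht⟩ := h.exists_quat_add_orthogonal he he0 a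
    have hJt := h.orthogonal_quatSpan_J ht
    have hGJt := h.orthogonal_quatSpan_Gend hJt
    rw [h.mem_orthogonal_quatSpan] at hJt hGJt
    rw [h.twist_apply hf hτperp hτ0 hτ1 hτ2 hτ3 α β γ δ ht] at heq
    have hJa : J (α • e + β • J e + γ • J (Gend e) + δ • Gend e + t) =
        (-β) • e + α • J e + δ • J (Gend e) + (-γ) • Gend e + J t := by
      simp only [map_add, map_smul, h.J_sq]
      module
    rw [hJa] at heq
    obtain ⟨p1, p2, -, -⟩ := h.gpairB_quat he (-(f ^ 2 * γ)) (f ^ 2 * δ) ((f ^ 2)⁻¹ * α)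
      (-((f ^ 2)⁻¹ * β))
    obtain ⟨q1, q2, -, -⟩ := h.gpairB_quat he (-β) α δ (-γ)
    have hγ : γ = σ * (f ^ 2)⁻¹ * β := by
      have := congrArg (fun w => gpairB V w e) heq
      simp only [map_smul, LinearMap.smul_apply] at this
      rw [LinearMap.map_add₂, p1, LinearMap.map_add₂, q1, hJt.1, hGJt.1, smul_eq_mul] at this
      apply mul_right_cancel₀ hg
      linarith
    have hδ : δ = σ * (f ^ 2)⁻¹ * α := by
      have := congrArg (fun w => gpairB V w (J e)) heq
      simp only [map_smul, LinearMap.smul_apply] at this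
      rw [LinearMap.map_add₂, p2, LinearMap.map_add₂, q2, hJt.2.1, hGJt.2.1, smul_eq_mul] at this
      apply mul_right_cancel₀ hg
      linarith
    refine ⟨α, β, t, ⟨ht, ?_⟩, ?_⟩
    · have h1 : σ * (f ^ 2 * γ) = β := by
        rw [hγ]; linear_combination β * σ * σ * hf2 + β * hσ
      have h2 : σ * (f ^ 2 * δ) = α := by
        rw [hδ]; linear_combination α * σ * σ * hf2 + α * hσ
      have h3 : σ * ((f ^ 2)⁻¹ * α) = δ := by rw [hδ]; ring
      have h4 : σ * ((f ^ 2)⁻¹ * β) = γ := by rw [hγ]; ring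
      simp only [smul_add, smul_smul, mul_neg, h1, h2, h3, h4] at heq
      exact add_left_cancel heq
    · rw [hγ, hδ, map_add, map_smul]
      module
  · rintro ⟨α, β, t, ⟨ht, htJ⟩, rfl⟩
    have ha : α • (e + (σ * (f ^ 2)⁻¹) • Gend e) + β • J (e + (σ * (f ^ 2)⁻¹) • Gend e) + t =
        α • e + β • J e + (σ * (f ^ 2)⁻¹ * β) • J (Gend e) + (σ * (f ^ 2)⁻¹ * α) • Gend e
          + t := by
      rw [map_add, map_smul]
      module
    rw [ha, h.twist_apply hf hτperp hτ0 hτ1 hτ2 hτ3 _ _ _ _ ht, smul_add, htJ]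
    simp only [map_add, map_smul, h.J_sq, smul_add, smul_smul, smul_neg]
    have h1 : σ * -(f ^ 2 * (σ * (f ^ 2)⁻¹ * β)) = -β := by
      linear_combination -β * σ * σ * hf2 - β * hσ
    have h2 : σ * (f ^ 2 * (σ * (f ^ 2)⁻¹ * α)) = α := by
      linear_combination α * σ * σ * hf2 + α * hσ
    rw [h1, h2]
    module

theorem fst_ne_of_orthogonal (h : IsGah G J Gend)
    {e t : GT V} (he : gpairB V e e = 0) (he0 : e ≠ 0) {σ c : ℝ}
    (hσ : σ ≠ 0) (hc : 0 < c) (ht : ∀ s ∈ quatSpan J Gend e, gpairB V t s = 0)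
    (htJ : σ • Gend (J t) = J t) : t.1 ≠ (e + (σ * c) • Gend e).1 := by
  intro heq
  have hz := gpairB_self_of_fst_eq_zero (u := t - (e + (σ * c) • Gend e))
    (by rw [Prod.fst_sub, heq, sub_self])
  rw [h.mem_orthogonal_quatSpan] at ht
  have hGt : σ • Gend t = t := by
    have := congrArg J htJ
    rw [map_smul, h.J_Gend_J, h.J_sq, smul_neg] at this
    exact neg_injective this
  have htt : gpairB V t t = σ * G t t := by
    nth_rw 1 [← hGt]
    rw [map_smul, LinearMap.smul_apply, ← h.gend_pair, smul_eq_mul]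
  have hG : gpairB V (Gend e) e = G e e := (h.gend_pair e e).symm
  have hG' : gpairB V e (Gend e) = G e e := by rw [gpairB_comm, hG]
  have hGG : gpairB V (Gend e) (Gend e) = 0 := by rw [h.gpairB_Gend_left, h.gend_sq, he]
  have h1 : gpairB V e t = 0 := by rw [gpairB_comm, ht.1]
  have h2 : gpairB V (Gend e) t = 0 := by rw [gpairB_comm, ht.2.2.2]
  simp only [map_sub, map_add, map_smul, LinearMap.sub_apply, LinearMap.add_apply,
    LinearMap.smul_apply, smul_eq_mul, htt, hG, hG', hGG, h1, h2, ht, he] at hz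
  have hpos : 0 < 2 * c * G e e + G t t := by
    have := h.posdef e he0
    have : 0 ≤ G t t := by
      by_cases h0 : t = 0
      · simp [h0]
      · exact (h.posdef t h0).le
    positivity
  exact mul_ne_zero hσ hpos.ne' (by linarith)

theorem toIEigen_mem_orthogonal_iff (h : IsGah G J Gend) {e t : GT V} :
    toIEigen J t ∈
        ((gpairB V).baseChange ℂ).orthogonal ((quatSpan J Gend e).baseChange ℂ) ↔
      ∀ s ∈ quatSpan J Gend e, gpairB V t s = 0 := by
  rw [toIEigen_eq_add, one_tmul_add_I_smul_mem_orthogonal]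
  constructor
  · intro H s hs
    rw [gpairB_comm, (H s hs).1]
  · intro H s hs
    rw [gpairB_comm, H s hs, map_neg, gpairB_comm, h.orthogonal_quatSpan_J H s hs, neg_zero]
    exact ⟨rfl, rfl⟩

theorem map_prTc_decomposition (h : IsGah G J Gend)
    {e : GT V} {f : ℝ} (hf : f ≠ 0) {τ : GT V ≃ₗ[ℝ] GT V}
    (hτperp : ∀ w, (∀ s ∈ quatSpan J Gend e, gpairB V w s = 0) → τ w = w)
    (hτ0 : τ e = f • e) (hτ1 : τ (J e) = f • J e)
    (hτ2 : τ (J (Gend e)) = f⁻¹ • J (Gend e)) (hτ3 : τ (Gend e) = f⁻¹ • Gend e)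
    (he : gpairB V e e = 0) (he0 : e ≠ 0) {σ : ℝ} (hσ : σ * σ = 1)
    {K K' : GT V →ₗ[ℝ] GT V} (hK : ∀ u, K u = σ • Gend (J u))
    (hK' : ∀ u, K' u = σ • τ (Gend (J (τ.symm u)))) {v : ℂ ⊗[ℝ] GT V}
    (hv : toIEigen J (e + (σ * (f ^ 2)⁻¹) • Gend e) = v) :
    letI N := iEigen J ⊓ iEigen K ⊓
      ((gpairB V).baseChange ℂ).orthogonal ((quatSpan J Gend e).baseChange ℂ)
    (iEigen J ⊓ iEigen K').map (prTc V) = (ℂ ∙ prTc V v) ⊔ N.map (prTc V) ∧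
      (ℂ ∙ prTc V v) ⊓ N.map (prTc V) = ⊥ ∧ prTc V v ∉ N.map (prTc V) := by
  have hKsq (u : GT V) : K (K u) = -u := by
    simp [hK, h.Gend_J, h.gend_sq, h.J_sq, smul_smul, hσ]
  have hKsq' (u : GT V) : K' (K' u) = -u := by
    simp [hK', h.Gend_J, h.gend_sq, h.J_sq, smul_smul, hσ]
  have hN (x : ℂ ⊗[ℝ] GT V) : x ∈ iEigen J ⊓ iEigen K ⊓
      ((gpairB V).baseChange ℂ).orthogonal ((quatSpan J Gend e).baseChange ℂ) ↔
      ∃ t, ((∀ s ∈ quatSpan J Gend e, gpairB V t s = 0) ∧ σ • Gend (J t) = J t) ∧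
        toIEigen J t = x := by
    rw [Submodule.mem_inf, mem_iEigen_inf h.J_sq hKsq]
    constructor
    · rintro ⟨⟨t, ht, rfl⟩, hp⟩
      exact ⟨t, ⟨h.toIEigen_mem_orthogonal_iff.1 hp, (hK t).symm.trans ht⟩, rfl⟩
    · rintro ⟨t, ⟨hp, ht⟩, rfl⟩
      exact ⟨⟨t, (hK t).trans ht, rfl⟩, h.toIEigen_mem_orthogonal_iff.2 hp⟩
  have hsup : iEigen J ⊓ iEigen K' = (ℂ ∙ v) ⊔ (iEigen J ⊓ iEigen K ⊓
      ((gpairB V).baseChange ℂ).orthogonal ((quatSpan J Gend e).baseChange ℂ)) := by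
    ext x
    rw [mem_iEigen_inf h.J_sq hKsq', Submodule.mem_sup]
    simp only [Submodule.mem_span_singleton, hN, hK',
      h.twist_eq_iff hf hτperp hτ0 hτ1 hτ2 hτ3 he he0 hσ]
    constructor
    · rintro ⟨_, ⟨α, β, t, ht, rfl⟩, rfl⟩
      refine ⟨_, ⟨⟨α, β⟩, rfl⟩, _, ⟨t, ht, rfl⟩, ?_⟩
      rw [← hv, smul_toIEigen h.J_sq, ← map_add]
    · rintro ⟨_, ⟨z, rfl⟩, _, ⟨t, ht, rfl⟩, rfl⟩
      refine ⟨_, ⟨z.re, z.im, t, ht, rfl⟩, ?_⟩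
      rw [← hv, smul_toIEigen h.J_sq, ← map_add]
  have hnot : prTc V v ∉ (iEigen J ⊓ iEigen K ⊓ ((gpairB V).baseChange ℂ).orthogonal
      ((quatSpan J Gend e).baseChange ℂ)).map (prTc V) := by
    rintro ⟨x, hx, hxv⟩
    obtain ⟨t, ⟨ht, htJ⟩, rfl⟩ := (hN x).1 hx
    rw [← hv, prTc_toIEigen_eq_iff] at hxv
    exact h.fst_ne_of_orthogonal he he0 (left_ne_zero_of_mul_eq_one hσ)
      (by positivity) ht htJ hxv.1
  refine ⟨?_, ?_, hnot⟩
  · rw [hsup, Submodule.map_sup, Submodule.map_span, Set.image_singleton]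
  · rw [inf_comm, ← disjoint_iff]
    exact Submodule.disjoint_span_singleton_of_notMem hnot

end IsGah

end Pairing


/-- the projections to `V_ℂ` satisfy the direct sum decompositions
`pr_T(L₁ ⊓ L₂') = ℂ·pr_T(v_f) ⊕ pr_T(L₁ ⊓ L₂ ⊓ S_ℂ^⊥)` and
`pr_T(L₁ ⊓ conj(L₂')) = ℂ·pr_T(v_{if}) ⊕ pr_T(L₁ ⊓ conj(L₂) ⊓ S_ℂ^⊥)`; in particular
`pr_T(v_f) ∉ pr_T(L₁ ⊓ L₂ ⊓ S_ℂ^⊥)` and `pr_T(v_{if}) ∉ pr_T(L₁ ⊓ conj(L₂) ⊓ S_ℂ^⊥)`. -/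
theorem statement14 {V : Type*} [AddCommGroup V] [Module ℝ V] [FiniteDimensional ℝ V]
    (G : GT V →ₗ[ℝ] GT V →ₗ[ℝ] ℝ) (J Gend : GT V →ₗ[ℝ] GT V)
    (hGah : IsGah G J Gend) (X₀ : V) (hX₀ : X₀ ≠ 0) (f : ℝ) (hf : f ≠ 0)
    (τ : GT V ≃ₗ[ℝ] GT V)
    (hτperp : ∀ w : GT V,
      (∀ s ∈ Submodule.span ℝ {((X₀, 0) : GT V), J (X₀, 0), (Gend ∘ₗ J) (X₀, 0),
          (J ∘ₗ Gend ∘ₗ J) (X₀, 0)}, gpairB V w s = 0) → τ w = w)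
    (hτ0 : τ ((X₀, 0) : GT V) = f • ((X₀, 0) : GT V))
    (hτ1 : τ (J (X₀, 0)) = f • J (X₀, 0))
    (hτ2 : τ ((Gend ∘ₗ J) (X₀, 0)) = f⁻¹ • (Gend ∘ₗ J) (X₀, 0))
    (hτ3 : τ ((J ∘ₗ Gend ∘ₗ J) (X₀, 0)) = f⁻¹ • (J ∘ₗ Gend ∘ₗ J) (X₀, 0)) :
    letI e : GT V := (X₀, 0)
    letI J₂ : GT V →ₗ[ℝ] GT V := Gend ∘ₗ J
    letI J₃ : GT V →ₗ[ℝ] GT V := J ∘ₗ Gend ∘ₗ J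
    letI S : Submodule ℝ (GT V) := Submodule.span ℝ {e, J e, J₂ e, J₃ e}
    letI J₂' : GT V →ₗ[ℝ] GT V := τ.toLinearMap ∘ₗ J₂ ∘ₗ τ.symm.toLinearMap
    letI L₁ := iEigen J
    letI L₂ := iEigen J₂
    letI L₂' := iEigen J₂'
    letI Scperp := ((gpairB V).baseChange ℂ).orthogonal (S.baseChange ℂ)
    letI ι : GT V → ℂ ⊗[ℝ] GT V := fun w => (1 : ℂ) ⊗ₜ[ℝ] w
    letI vf : ℂ ⊗[ℝ] GT V := ι e - Complex.I • ι (J e)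
      - ((f : ℂ) ^ 2)⁻¹ • (ι (J₃ e) + Complex.I • ι (J₂ e))
    letI vif : ℂ ⊗[ℝ] GT V := ι e - Complex.I • ι (J e)
      + ((f : ℂ) ^ 2)⁻¹ • (ι (J₃ e) + Complex.I • ι (J₂ e))
    ((L₁ ⊓ L₂').map (prTc V) =
        (ℂ ∙ prTc V vf) ⊔ (L₁ ⊓ L₂ ⊓ Scperp).map (prTc V) ∧
      (ℂ ∙ prTc V vf) ⊓ (L₁ ⊓ L₂ ⊓ Scperp).map (prTc V) = ⊥ ∧
      prTc V vf ∉ (L₁ ⊓ L₂ ⊓ Scperp).map (prTc V)) ∧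
    ((L₁ ⊓ L₂'.map (conjC (GT V))).map (prTc V) =
        (ℂ ∙ prTc V vif) ⊔ (L₁ ⊓ L₂.map (conjC (GT V)) ⊓ Scperp).map (prTc V) ∧
      (ℂ ∙ prTc V vif) ⊓ (L₁ ⊓ L₂.map (conjC (GT V)) ⊓ Scperp).map (prTc V) = ⊥ ∧
      prTc V vif ∉ (L₁ ⊓ L₂.map (conjC (GT V)) ⊓ Scperp).map (prTc V)) := by
  have hJ₂ (u : GT V) : (Gend ∘ₗ J) u = J (Gend u) := hGah.Gend_J u
  have hJ₃ (u : GT V) : (J ∘ₗ Gend ∘ₗ J) u = -Gend u := hGah.J_Gend_J u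
  have he : gpairB V ((X₀, 0) : GT V) (X₀, 0) = 0 := by simp [gpairB_apply]
  have he0 : ((X₀, 0) : GT V) ≠ 0 := fun H => hX₀ (congrArg Prod.fst H)
  have hτ3' : τ (Gend (X₀, 0)) = f⁻¹ • Gend (X₀, 0) := by
    rw [hJ₃, map_neg, smul_neg] at hτ3
    exact neg_injective hτ3
  rw [hJ₂] at hτ2
  rw [map_conjC_iEigen, map_conjC_iEigen]
  have hv (c : ℝ) : toIEigen J ((X₀, 0) + c • Gend (X₀, 0)) =
      (1 : ℂ) ⊗ₜ[ℝ] ((X₀, 0) : GT V) - Complex.I • (1 : ℂ) ⊗ₜ[ℝ] J (X₀, 0)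
        - (c : ℂ) • ((1 : ℂ) ⊗ₜ[ℝ] (J ∘ₗ Gend ∘ₗ J) (X₀, 0)
          + Complex.I • (1 : ℂ) ⊗ₜ[ℝ] (Gend ∘ₗ J) (X₀, 0)) := by
    have hc (x : ℂ ⊗[ℝ] GT V) : c • x = (c : ℂ) • x := (algebraMap_smul ℂ c x).symm
    rw [hJ₂, hJ₃, toIEigen_apply, map_add, map_smul, tmul_add, tmul_add, tmul_smul, tmul_smul,
      tmul_neg, hc, hc]
    module
  constructor
  · refine hGah.map_prTc_decomposition (σ := 1) hf hτperp hτ0 hτ1 hτ2 hτ3' he he0 (by norm_num)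
      (fun u => (one_smul ℝ _).symm) (fun u => (one_smul ℝ _).symm) ?_
    rw [hv]
    push_cast
    rw [one_mul]
  · refine hGah.map_prTc_decomposition (σ := -1) hf hτperp hτ0 hτ1 hτ2 hτ3' he he0 (by norm_num)
      (fun u => (neg_one_smul ℝ _).symm) (fun u => (neg_one_smul ℝ _).symm) ?_
    rw [hv]
    push_cast
    rw [neg_one_mul, neg_smul, sub_neg_eq_add]
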